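/- Let K be a monotone kernel function, n ∈ ℕ, r₁,…,rₙ > 0 with R := r₁ + … + rₙ, and let J be an n-field function on ℝ that is R-admissible for K. If, in addition, J is upper semicontinuous or K is singular, then there exists an equioscillation point on ℝ, i.e., a point e ∈ S^∞ with m₀(e) = m₁(e) = … = mₙ(e). -/

import Mathlib

open Filter Set Topology

noncomputable section

/-- A kernel function: finite on `ℝ \ {0}`, concave on `(-∞,0)` and `(0,∞)`,
with equal one-sided limits at `0`, equal to `K 0` (real or `⊥`). -/
def IsKernel (K : ℝ → EReal) : Prop :=
  (∀ t : ℝ, t ≠ 0 → K t ≠ ⊥ ∧ K t ≠ ⊤) ∧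
  ConcaveOn ℝ (Iio (0:ℝ)) (fun t => (K t).toReal) ∧
  ConcaveOn ℝ (Ioi (0:ℝ)) (fun t => (K t).toReal) ∧
  K 0 ≠ ⊤ ∧
  Tendsto K (𝓝[<] (0:ℝ)) (𝓝 (K 0)) ∧
  Tendsto K (𝓝[>] (0:ℝ)) (𝓝 (K 0))

/-- A monotone kernel: nonincreasing on `(-∞,0)`, nondecreasing on `(0,∞)`. -/
def MonotoneKernel (K : ℝ → EReal) : Prop :=
  IsKernel K ∧ AntitoneOn K (Iio (0:ℝ)) ∧ MonotoneOn K (Ioi (0:ℝ))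

/-- An `n`-field function on `ℝ`: bounded above, finite at more than `n` points. -/
def IsFieldFn (n : ℕ) (J : ℝ → EReal) : Prop :=
  (∃ c : ℝ, ∀ t, J t ≤ (c : EReal)) ∧
  (∃ S : Finset ℝ, n < S.card ∧ ∀ x ∈ S, J x ≠ ⊥)

/-- `J` is `R`-admissible for `K`: `J(t) + R·K(t) → -∞` as `|t| → ∞`. -/
def IsAdmissible (K J : ℝ → EReal) (R : ℝ) : Prop :=
  Tendsto (fun t => J t + (R : EReal) * K t) (cocompact ℝ) (𝓝 ⊥)

/-- The sum of translates function `F(y,t) = J(t) + ∑ rⱼ K(t - yⱼ)`. -/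
def SumTrans (K J : ℝ → EReal) {n : ℕ} (r y : Fin n → ℝ) (t : ℝ) : EReal :=
  J t + ∑ j, (r j : EReal) * K (t - y j)

/-- For monotone `y`, `cell y j` is `[y_j, y_{j+1}]` (with `y_0 = -∞`, `y_{n+1} = ∞`). -/
def cell {n : ℕ} (y : Fin n → ℝ) (j : Fin (n+1)) : Set ℝ :=
  {t | (∀ i : Fin n, (i : ℕ) < (j : ℕ) → y i ≤ t) ∧ (∀ i : Fin n, (j : ℕ) ≤ (i : ℕ) → t ≤ y i)}

/-- The local maximum `mⱼ(y)` over the `j`-th cell. -/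
def mloc (K J : ℝ → EReal) {n : ℕ} (r y : Fin n → ℝ) (j : Fin (n+1)) : EReal :=
  sSup (SumTrans K J r y '' cell y j)

/-- The local maximum `mⱼ^b(y)` over the `j`-th cell intersected with `[-b,b]`. -/
def mlocSeg (K J : ℝ → EReal) {n : ℕ} (r y : Fin n → ℝ) (b : ℝ) (j : Fin (n+1)) : EReal :=
  sSup (SumTrans K J r y '' (cell y j ∩ Icc (-b) b))

/-- `q` has the Mhaskar–Rakhmanov–Saff property for `(K, J, R)` (with `n` nodes). -/
def HasMRS (K J : ℝ → EReal) (R : ℝ) (n : ℕ) (q : ℝ) : Prop :=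
  ∀ r : Fin n → ℝ, (∀ j, 0 < r j) → (∑ j, r j) ≤ R →
    ∀ y : Fin n → ℝ, Monotone y →
      sSup (range (SumTrans K J r y)) = sSup (SumTrans K J r y '' Icc (-q) q)

/-- Vertex number `k` of the Kuhn simplex with base point `s.1` and step order `s.2`. -/
def kuhnVertex {n M : ℕ} (s : (Fin n → Fin (M + 1)) × Equiv.Perm (Fin n)) (k : ℕ) : Fin n → ℕ :=
  fun i => (s.1 i : ℕ) + if (s.2 i : ℕ) < k then 1 else 0

/-- A Sperner-type labelling of the grid `{0, …, M + 1}ⁿ` by `0, …, n`. -/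
def IsCubeLabelling (M : ℕ) {n : ℕ} (l : (Fin n → ℕ) → ℕ) : Prop :=
  ∀ p : Fin n → ℕ, (∀ i, p i ≤ M + 1) →
    l p ≤ n ∧ ∀ i, (p i = M + 1 → l p ≠ i) ∧ (p i = 0 → l p ≤ i)

/-- Incidence matrix, modulo two, between a finite family of labels and `c, …, c + m - 1`. -/
def labelMatrix {m : ℕ} (f : Fin m → ℕ) (c : ℕ) : Matrix (Fin m) (Fin m) (ZMod 2) :=
  Matrix.of fun i j => if f i = j + c then 1 else 0

lemma det_labelMatrix_eq_zero {m : ℕ} {f : Fin m → ℕ} {c : ℕ} (j : Fin m)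
    (h : ∀ i, f i ≠ j + c) : (labelMatrix f c).det = 0 :=
  Matrix.det_eq_zero_of_column_eq_zero j fun i => by simp [labelMatrix, h i]

lemma det_labelMatrix_succ {m : ℕ} (f : Fin (m + 1) → ℕ) (hf : ∀ i, f i ≤ m) :
    (labelMatrix f 0).det =
      ∑ k : Fin (m + 1), (labelMatrix (fun j => f (k.succAbove j)) 1).det := by
  have h1 := Matrix.det_updateCol_sum (labelMatrix f 0) 0 (fun _ => 1)
  have h2 : (fun k => ∑ i, (1 : ZMod 2) • labelMatrix f 0 k i) = fun _ => 1 := by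
    funext k
    rw [Finset.sum_eq_single (⟨f k, Nat.lt_succ_of_le (hf k)⟩ : Fin (m + 1))]
    · simp [labelMatrix]
    · intro b _ hb
      have : f k ≠ b := fun h => hb (Fin.ext h.symm)
      simp [labelMatrix, this]
    · simp
  rw [h2, one_smul] at h1
  rw [← h1, Matrix.det_succ_column_zero]
  refine Finset.sum_congr rfl fun k _ => ?_
  have h3 : ((-1 : ZMod 2)) = 1 := by decide
  rw [h3, one_pow, one_mul, Matrix.updateCol_self, one_mul]
  congr 1

lemma kuhnVertex_le {n M : ℕ} (s : (Fin n → Fin (M + 1)) × Equiv.Perm (Fin n)) (k : ℕ)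
    (i : Fin n) : kuhnVertex s k i ≤ M + 1 := by
  have := (s.1 i).isLt
  unfold kuhnVertex
  split_ifs <;> omega

/-- The determinant recording whether the facet opposite to vertex `k` carries the labels
`1, …, n`. -/
def facetDet {n M : ℕ} (l : (Fin n → ℕ) → ℕ)
    (s : (Fin n → Fin (M + 1)) × Equiv.Perm (Fin n)) (k : Fin (n + 1)) : ZMod 2 :=
  (labelMatrix (fun j : Fin n => l (kuhnVertex s (k.succAbove j))) 1).det

lemma sum_facetDet_interior {n M : ℕ} (l : (Fin (n + 1) → ℕ) → ℕ) (k : Fin n) :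
    ∑ s : (Fin (n + 1) → Fin (M + 1)) × Equiv.Perm (Fin (n + 1)),
      facetDet l s k.succ.castSucc = 0 := by
  have hne : k.castSucc ≠ k.succ := by simp [Fin.ext_iff]
  refine Finset.sum_involution (fun s _ => (s.1, Equiv.swap k.castSucc k.succ * s.2)) ?_ ?_ ?_ ?_
  · intro s _
    have : facetDet l (s.1, Equiv.swap k.castSucc k.succ * s.2) k.succ.castSucc
        = facetDet l s k.succ.castSucc := by
      unfold facetDet
      congr 2
      funext j
      congr 1
      funext i
      unfold kuhnVertex
      have hj : ((k.succ.castSucc.succAbove j : Fin (n + 2)) : ℕ) ≠ k + 1 := by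
        intro h
        exact Fin.succAbove_ne k.succ.castSucc j (Fin.ext (by simpa using h))
      generalize ((k.succ.castSucc.succAbove j : Fin (n + 2)) : ℕ) = m at hj
      congr 2
      simp only [Equiv.Perm.mul_apply, eq_iff_iff]
      by_cases h1 : s.2 i = k.castSucc
      · rw [h1, Equiv.swap_apply_left, Fin.val_succ, Fin.val_castSucc]; omega
      · by_cases h2 : s.2 i = k.succ
        · rw [h2, Equiv.swap_apply_right, Fin.val_succ, Fin.val_castSucc]; omega
        · rw [Equiv.swap_apply_of_ne_of_ne h1 h2]
    rw [this]
    exact CharTwo.add_self_eq_zero _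
  · intro s _ _ h
    have h' := congrArg Prod.snd h
    simp only at h'
    have : Equiv.swap k.castSucc k.succ = 1 := mul_eq_right.mp h'
    exact hne (Equiv.swap_eq_one_iff.mp this)
  · intro s _; simp
  · intro s _; ext <;> simp [← mul_assoc]

/-- Passing from a Kuhn simplex to its neighbour across the facet opposite to vertex `0`, with
periodic wrap-around. -/
def kuhnShift {n M : ℕ} (s : (Fin (n + 1) → Fin (M + 1)) × Equiv.Perm (Fin (n + 1))) :
    (Fin (n + 1) → Fin (M + 1)) × Equiv.Perm (Fin (n + 1)) :=
  (fun i => if s.2 i = 0 then s.1 i + 1 else s.1 i, (finRotate (n + 1))⁻¹ * s.2)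

lemma kuhnShift_bijective {n M : ℕ} : Function.Bijective (kuhnShift (n := n) (M := M)) := by
  refine Finite.injective_iff_bijective.mp ?_
  rintro ⟨v, σ⟩ ⟨w, τ⟩ h
  simp only [kuhnShift, Prod.mk.injEq] at h
  obtain ⟨h1, h2⟩ := h
  have h2 : σ = τ := mul_left_cancel h2
  subst h2
  refine Prod.ext (funext fun i => ?_) rfl
  have := congrFun h1 i
  split_ifs at this
  · exact add_right_cancel this
  · exact this

lemma coe_finRotate_inv {n : ℕ} (a : Fin (n + 1)) :
    (((finRotate (n + 1))⁻¹ a : Fin (n + 1)) : ℕ) = if a = 0 then n else (a : ℕ) - 1 := by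
  obtain ⟨b, rfl⟩ := (finRotate (n + 1)).surjective a
  rw [Equiv.Perm.inv_def, Equiv.symm_apply_apply]
  rcases Fin.eq_castSucc_or_eq_last b with ⟨c, rfl⟩ | rfl
  · simp [Fin.ext_iff]
  · simp

lemma kuhnVertex_kuhnShift {n M : ℕ}
    (s : (Fin (n + 1) → Fin (M + 1)) × Equiv.Perm (Fin (n + 1)))
    (hs : s.1 (s.2.symm 0) ≠ Fin.last M) {k : ℕ} (hk : k ≤ n) :
    kuhnVertex (kuhnShift s) k = kuhnVertex s (k + 1) := by
  funext i
  simp only [kuhnVertex, kuhnShift, Equiv.Perm.mul_apply, coe_finRotate_inv]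
  by_cases h : s.2 i = 0
  · have hi : i = s.2.symm 0 := by rw [← h]; simp
    have : s.1 i ≠ Fin.last M := by rw [hi]; exact hs
    simp [h, Fin.val_add_one, this]
    omega
  · have : (s.2 i : ℕ) ≠ 0 := fun h' => h (Fin.ext h')
    simp only [h, if_false]
    congr 2
    simp only [eq_iff_iff]; omega

lemma facetDet_last_kuhnShift {n M : ℕ} (l : (Fin (n + 1) → ℕ) → ℕ) (hl : IsCubeLabelling M l)
    (s : (Fin (n + 1) → Fin (M + 1)) × Equiv.Perm (Fin (n + 1))) :
    facetDet l (kuhnShift s) (Fin.last (n + 1)) =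
      if s.1 (s.2.symm 0) = Fin.last M then 0 else facetDet l s 0 := by
  split_ifs with h
  · refine det_labelMatrix_eq_zero (Fin.last n) fun j => ?_
    have := ((hl _ (kuhnVertex_le (kuhnShift s) ((Fin.last (n + 1)).succAbove j))).2
      (s.2.symm 0)).2 ?_
    · have h2 := (s.2.symm 0).isLt
      simp only [Fin.val_last]; omega
    · simp [kuhnVertex, kuhnShift, h]
      omega
  · unfold facetDet
    congr 2
    funext j
    rw [Fin.succAbove_last, Fin.succAbove_zero, Fin.val_succ, Fin.val_castSucc,
      kuhnVertex_kuhnShift s h (by omega)]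

lemma facetDet_zero_of_wrap {n M : ℕ} (l : (Fin (n + 1) → ℕ) → ℕ) (hl : IsCubeLabelling M l)
    (s : (Fin (n + 1) → Fin (M + 1)) × Equiv.Perm (Fin (n + 1)))
    (h : s.1 (s.2.symm 0) = Fin.last M) (h0 : s.2.symm 0 ≠ 0) : facetDet l s 0 = 0 := by
  obtain ⟨i, hi⟩ := Fin.exists_succ_eq.mpr h0
  refine det_labelMatrix_eq_zero i.castSucc fun j => ?_
  have := ((hl _ (kuhnVertex_le s ((0 : Fin (n + 2)).succAbove j))).2 (s.2.symm 0)).1 ?_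
  · rw [← hi] at this
    simpa using this
  · simp [kuhnVertex, h]

lemma sum_facetDet {n M : ℕ} (l : (Fin (n + 1) → ℕ) → ℕ) (hl : IsCubeLabelling M l) :
    ∑ s : (Fin (n + 1) → Fin (M + 1)) × Equiv.Perm (Fin (n + 1)), ∑ k, facetDet l s k =
    ∑ s : (Fin (n + 1) → Fin (M + 1)) × Equiv.Perm (Fin (n + 1)),
      if s.2 0 = 0 ∧ s.1 0 = Fin.last M then facetDet l s 0 else 0 := by
  rw [Finset.sum_comm, Fin.sum_univ_castSucc, Fin.sum_univ_succ]
  simp only [sum_facetDet_interior, Finset.sum_const_zero, add_zero]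
  rw [← kuhnShift_bijective.sum_comp (fun s => facetDet l s (Fin.last (n + 1))),
    ← Finset.sum_add_distrib]
  refine Finset.sum_congr rfl fun s _ => ?_
  rw [facetDet_last_kuhnShift l hl, Fin.castSucc_zero]
  by_cases h : s.1 (s.2.symm 0) = Fin.last M
  · by_cases h0 : s.2.symm 0 = 0
    · have h1 : s.2 0 = 0 := ((Equiv.symm_apply_eq _).mp h0).symm
      have h2 : s.1 0 = Fin.last M := by rwa [h0] at h
      rw [if_pos h, if_pos ⟨h1, h2⟩, add_zero]
    · rw [if_pos h, facetDet_zero_of_wrap l hl s h h0]; simp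
  · rw [if_neg h, if_neg, CharTwo.add_self_eq_zero]
    rintro ⟨h1, h2⟩
    refine h ?_
    rwa [(Equiv.symm_apply_eq _).mpr h1.symm]

/-- Embedding of Kuhn simplices into the boundary face where coordinate `0` is maximal. -/
def kuhnCons {n M : ℕ} (s : (Fin n → Fin (M + 1)) × Equiv.Perm (Fin n)) :
    (Fin (n + 1) → Fin (M + 1)) × Equiv.Perm (Fin (n + 1)) :=
  (Fin.cons (Fin.last M) s.1, Equiv.Perm.decomposeFin.symm (0, s.2))

lemma kuhnVertex_kuhnCons {n M : ℕ} (s : (Fin n → Fin (M + 1)) × Equiv.Perm (Fin n)) (k : ℕ) :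
    kuhnVertex (kuhnCons s) (k + 1) = Fin.cons (M + 1) (kuhnVertex s k) := by
  funext i
  refine Fin.cases ?_ (fun i => ?_) i <;> simp [kuhnVertex, kuhnCons]

lemma sum_kuhnCons {n M : ℕ}
    (g : (Fin (n + 1) → Fin (M + 1)) × Equiv.Perm (Fin (n + 1)) → ZMod 2) :
    (∑ s, if s.2 0 = 0 ∧ s.1 0 = Fin.last M then g s else 0) = ∑ s, g (kuhnCons s) := by
  rw [← Finset.sum_filter]
  symm
  refine Finset.sum_bij (fun s _ => kuhnCons s) ?_ ?_ ?_ ?_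
  · intro s _; simp [kuhnCons]
  · rintro ⟨v, σ⟩ _ ⟨w, τ⟩ _ h
    simpa [kuhnCons, Fin.cons_inj] using h
  · rintro ⟨v, σ⟩ h
    simp only [Finset.mem_filter, Finset.mem_univ, true_and] at h
    obtain ⟨⟨p, τ⟩, rfl⟩ := Equiv.Perm.decomposeFin.symm.surjective σ
    have hp : p = 0 := by simpa using h.1
    subst hp
    refine ⟨(Fin.tail v, τ), Finset.mem_univ _, ?_⟩
    refine Prod.ext ?_ rfl
    simp only [kuhnCons]
    rw [← h.2]; exact Fin.cons_self_tail v
  · intros; rfl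

theorem sum_det_labelMatrix (M : ℕ) : ∀ (n : ℕ) (l : (Fin n → ℕ) → ℕ), IsCubeLabelling M l →
    ∑ s : (Fin n → Fin (M + 1)) × Equiv.Perm (Fin n),
      (labelMatrix (fun k : Fin (n + 1) => l (kuhnVertex s k)) 0).det = 1
  | 0, l, hl => by
    have : ∀ p, l p = 0 := fun p => Nat.le_zero.mp (hl p (fun i => i.elim0)).1
    simp [labelMatrix, this]
  | n + 1, l, hl => by
    have hcons : ∀ p : Fin n → ℕ, (∀ i, p i ≤ M + 1) →
        ∀ i, (Fin.cons (M + 1) p : Fin (n + 1) → ℕ) i ≤ M + 1 := by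
      intro p hp i
      refine Fin.cases ?_ (fun i => ?_) i
      · simp
      · simpa using hp i
    have hpos : ∀ p : Fin n → ℕ, (∀ i, p i ≤ M + 1) → l (Fin.cons (M + 1) p) ≠ 0 := fun p hp =>
      ((hl _ (hcons p hp)).2 0).1 (by simp)
    have hl' : IsCubeLabelling M (fun p : Fin n → ℕ => l (Fin.cons (M + 1) p) - 1) := by
      intro p hp
      have h0 := hpos p hp
      have h1 := hl _ (hcons p hp)
      refine ⟨by have := h1.1; simp only; omega, fun i => ⟨fun h => ?_, fun h => ?_⟩⟩
      · have := (h1.2 i.succ).1 (by simpa using h)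
        simp only [Fin.val_succ] at this; simp only; omega
      · have := (h1.2 i.succ).2 (by simpa using h)
        simp only [Fin.val_succ] at this; simp only; omega
    rw [← sum_det_labelMatrix M n _ hl']
    have h1 : ∀ s : (Fin (n + 1) → Fin (M + 1)) × Equiv.Perm (Fin (n + 1)),
        (labelMatrix (fun k : Fin (n + 2) => l (kuhnVertex s k)) 0).det =
          ∑ k, facetDet l s k := fun s =>
      det_labelMatrix_succ _ fun k => (hl _ (kuhnVertex_le s k)).1
    simp only [h1]
    rw [sum_facetDet l hl, sum_kuhnCons]
    refine Finset.sum_congr rfl fun s _ => ?_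
    unfold facetDet labelMatrix
    congr 2
    funext i j
    have h0 := hpos _ (kuhnVertex_le s i)
    simp only [Fin.succAbove_zero, Fin.val_succ, kuhnVertex_kuhnCons]
    congr 1
    simp only [eq_iff_iff]; omega

/-- A cubical Sperner lemma. -/
theorem IsCubeLabelling.exists_full_cube {M n : ℕ} {l : (Fin n → ℕ) → ℕ}
    (hl : IsCubeLabelling M l) :
    ∃ v : Fin n → ℕ, (∀ i, v i ≤ M) ∧
      ∀ j ≤ n, ∃ p : Fin n → ℕ, (∀ i, v i ≤ p i ∧ p i ≤ v i + 1) ∧ l p = j := by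
  have h : (∑ s : (Fin n → Fin (M + 1)) × Equiv.Perm (Fin n),
      (labelMatrix (fun k : Fin (n + 1) => l (kuhnVertex s k)) 0).det) ≠ 0 := by
    rw [sum_det_labelMatrix M n l hl]; exact one_ne_zero
  obtain ⟨s, -, hs⟩ := Finset.exists_ne_zero_of_sum_ne_zero h
  refine ⟨fun i => s.1 i, fun i => Nat.lt_succ_iff.mp (s.1 i).isLt, fun j hj => ?_⟩
  by_contra hcon
  push Not at hcon
  refine hs (det_labelMatrix_eq_zero ⟨j, Nat.lt_succ_of_le hj⟩ fun k => ?_)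
  refine hcon _ fun i => ?_
  unfold kuhnVertex
  split_ifs <;> omega

/-- A covering theorem of Knaster–Kuratowski–Mazurkiewicz type for the cube. -/
theorem exists_mem_closure_of_cube_labelling {n : ℕ} (l : (Fin n → ℝ) → ℕ)
    (hle : ∀ x ∈ Icc (0 : Fin n → ℝ) 1, l x ≤ n)
    (hone : ∀ x ∈ Icc (0 : Fin n → ℝ) 1, ∀ i, x i = 1 → l x ≠ i)
    (hzero : ∀ x ∈ Icc (0 : Fin n → ℝ) 1, ∀ i, x i = 0 → l x ≤ i) :
    ∃ x ∈ Icc (0 : Fin n → ℝ) 1, ∀ j ≤ n, x ∈ closure {z ∈ Icc (0 : Fin n → ℝ) 1 | l z = j} := by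
  have key : ∀ M : ℕ, ∃ x ∈ Icc (0 : Fin n → ℝ) 1, ∀ j ≤ n,
      ∃ z ∈ {z ∈ Icc (0 : Fin n → ℝ) 1 | l z = j}, dist x z ≤ 1 / ((M : ℝ) + 1) := by
    intro M
    have hM : (0 : ℝ) < (M : ℝ) + 1 := by positivity
    set φ : (Fin n → ℕ) → Fin n → ℝ := fun p i => (p i : ℝ) / ((M : ℝ) + 1) with hφ
    have hmem : ∀ p : Fin n → ℕ, (∀ i, p i ≤ M + 1) → φ p ∈ Icc (0 : Fin n → ℝ) 1 := by
      intro p hp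
      refine ⟨fun i => by simp only [hφ, Pi.zero_apply]; positivity, fun i => ?_⟩
      simp only [hφ, Pi.one_apply, div_le_one hM]
      exact_mod_cast hp i
    have hlab : IsCubeLabelling M (fun p => l (φ p)) := by
      intro p hp
      refine ⟨hle _ (hmem p hp), fun i => ⟨fun h => hone _ (hmem p hp) i ?_,
        fun h => hzero _ (hmem p hp) i ?_⟩⟩
      · simp only [hφ, h]; push_cast; exact div_self hM.ne'
      · simp [hφ, h]
    obtain ⟨v, hv, hfull⟩ := hlab.exists_full_cube
    refine ⟨φ v, hmem v fun i => (hv i).trans (Nat.le_succ M), fun j hj => ?_⟩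
    obtain ⟨p, hp, hpj⟩ := hfull j hj
    refine ⟨φ p, ⟨hmem p fun i => ?_, hpj⟩, ?_⟩
    · have := (hp i).2; have := hv i; omega
    · rw [dist_pi_le_iff (by positivity)]
      intro i
      have h1 : (v i : ℝ) ≤ p i := by exact_mod_cast (hp i).1
      have h2 : (p i : ℝ) ≤ v i + 1 := by exact_mod_cast (hp i).2
      simp only [hφ]
      rw [Real.dist_eq, ← sub_div, abs_div, abs_of_pos hM]
      gcongr
      rw [abs_le]; constructor <;> linarith
  choose x hx hz using key
  obtain ⟨a, ha, φ, hφ, hlim⟩ := (isCompact_Icc (a := (0 : Fin n → ℝ)) (b := 1)).tendsto_subseq hx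
  refine ⟨a, ha, fun j hj => ?_⟩
  choose z hz hd using fun M => hz M j hj
  refine mem_closure_of_tendsto (f := fun k => z (φ k)) (b := atTop) ?_
    (Eventually.of_forall fun k => hz (φ k))
  have h0 : Tendsto (fun k => dist (x (φ k)) (z (φ k))) atTop (𝓝 0) :=
    squeeze_zero (fun _ => dist_nonneg) (fun k => hd (φ k))
      (tendsto_one_div_add_atTop_nhds_zero_nat.comp hφ.tendsto_atTop)
  exact (tendsto_iff_of_dist h0).mp hlim

lemma ConcaveOn.add_le_add_of_pos {f : ℝ → ℝ} (hf : ConcaveOn ℝ (Ioi 0) f) {p q h : ℝ}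
    (hp : 0 < p) (hpq : p ≤ q) (hh : 0 ≤ h) : f (q + h) + f p ≤ f (p + h) + f q := by
  rcases hpq.eq_or_lt with rfl | hlt
  · exact le_rfl
  have hd : 0 < q + h - p := by linarith
  have hp' : p ∈ Ioi (0 : ℝ) := hp
  have hq' : q + h ∈ Ioi (0 : ℝ) := by simp only [mem_Ioi]; linarith
  have h1 := hf.2 hp' hq' (div_nonneg (sub_nonneg.mpr hpq) hd.le) (div_nonneg hh hd.le)
    (by field_simp; ring)
  have h2 := hf.2 hp' hq' (div_nonneg hh hd.le) (div_nonneg (sub_nonneg.mpr hpq) hd.le)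
    (by field_simp; ring)
  have e1 : ((q - p) / (q + h - p)) • p + (h / (q + h - p)) • (q + h) = p + h := by
    simp only [smul_eq_mul]; field_simp; ring
  have e2 : (h / (q + h - p)) • p + ((q - p) / (q + h - p)) • (q + h) = q := by
    simp only [smul_eq_mul]; field_simp; ring
  rw [e1] at h1
  rw [e2] at h2
  have e3 : ((q - p) / (q + h - p)) + (h / (q + h - p)) = 1 := by field_simp; ring
  simp only [smul_eq_mul] at h1 h2
  have e4 : f p + f (q + h) = ((q - p) / (q + h - p) + h / (q + h - p)) * (f p + f (q + h)) := by
    rw [e3, one_mul]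
  linarith

lemma EReal.coe_finset_sum {ι : Type*} (s : Finset ι) (f : ι → ℝ) :
    ((∑ i ∈ s, f i : ℝ) : EReal) = ∑ i ∈ s, (f i : EReal) := by
  classical
  induction s using Finset.induction_on with
  | empty => simp
  | insert a s ha ih => rw [Finset.sum_insert ha, Finset.sum_insert ha, EReal.coe_add, ih]

lemma IsKernel.coe_toReal {K : ℝ → EReal} (hK : IsKernel K) {t : ℝ} (ht : t ≠ 0) :
    ((K t).toReal : EReal) = K t :=
  EReal.coe_toReal (hK.1 t ht).2 (hK.1 t ht).1

lemma IsKernel.ne_top {K : ℝ → EReal} (hK : IsKernel K) (t : ℝ) : K t ≠ ⊤ := by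
  rcases eq_or_ne t 0 with rfl | ht
  · exact hK.2.2.2.1
  · exact (hK.1 t ht).2

lemma IsKernel.continuous {K : ℝ → EReal} (hK : IsKernel K) : Continuous K := by
  rw [continuous_iff_continuousAt]
  intro t
  have key : ∀ U : Set ℝ, IsOpen U → ConcaveOn ℝ U (fun t => (K t).toReal) → 0 ∉ U → t ∈ U →
      ContinuousAt K t := by
    intro U hU hc h0 ht
    have h1 : ContinuousAt (fun t => (((K t).toReal : ℝ) : EReal)) t :=
      continuous_coe_real_ereal.continuousAt.comp
        ((hc.continuousOn hU).continuousAt (hU.mem_nhds ht))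
    refine h1.congr ?_
    filter_upwards [hU.mem_nhds ht] with s hs
    exact hK.coe_toReal fun h => h0 (h ▸ hs)
  rcases lt_trichotomy t 0 with ht | rfl | ht
  · exact key _ isOpen_Iio hK.2.1 (by simp) ht
  · exact continuousAt_iff_continuous_left'_right'.mpr ⟨hK.2.2.2.2.1, hK.2.2.2.2.2⟩
  · exact key _ isOpen_Ioi hK.2.2.1 (by simp) ht

lemma MonotoneKernel.apply_zero_le {K : ℝ → EReal} (hK : MonotoneKernel K) (t : ℝ) :
    K 0 ≤ K t := by
  rcases lt_trichotomy t 0 with ht | rfl | ht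
  · refine le_of_tendsto hK.1.2.2.2.2.1 ?_
    filter_upwards [Ioo_mem_nhdsLT ht] with s hs
    exact hK.2.1 ht hs.2 hs.1.le
  · exact le_rfl
  · refine le_of_tendsto hK.1.2.2.2.2.2 ?_
    filter_upwards [Ioo_mem_nhdsGT ht] with s hs
    exact hK.2.2 hs.1 ht hs.2.le

lemma MonotoneKernel.comp_neg {K : ℝ → EReal} (hK : MonotoneKernel K) :
    MonotoneKernel (fun t => K (-t)) := by
  have hc := hK.1.continuous.comp continuous_neg
  refine ⟨⟨fun t ht => hK.1.1 _ (neg_ne_zero.mpr ht), ?_, ?_, by simpa using hK.1.2.2.2.1,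
    hc.continuousWithinAt, hc.continuousWithinAt⟩, ?_, ?_⟩
  · have := hK.1.2.2.1.comp_linearMap (-LinearMap.id : ℝ →ₗ[ℝ] ℝ)
    convert! this using 1
    ext t; simp
  · have := hK.1.2.1.comp_linearMap (-LinearMap.id : ℝ →ₗ[ℝ] ℝ)
    convert! this using 1
    ext t; simp
  · intro s hs t ht hst
    exact hK.2.2 (mem_Ioi.mpr (neg_pos.mpr ht)) (mem_Ioi.mpr (neg_pos.mpr hs)) (neg_le_neg hst)
  · intro s hs t ht hst
    exact hK.2.1 (mem_Iio.mpr (neg_lt_zero.mpr ht)) (mem_Iio.mpr (neg_lt_zero.mpr hs))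
      (neg_le_neg hst)

lemma MonotoneKernel.exists_tail_bound_right {K : ℝ → EReal} (hK : MonotoneKernel K) {a δ : ℝ}
    (ha : 0 < a) (hδ : 0 < δ) :
    ∃ C : ℝ, ∀ t, a + 1 ≤ t → ∀ x y : ℝ, |x| ≤ a → δ ≤ |x - y| →
      K (t - y) ≤ (((K (x - y)).toReal + (K t).toReal + C : ℝ) : EReal) := by
  set k : ℝ → ℝ := fun s => (K s).toReal with hk
  have hKk : ∀ s, s ≠ 0 → K s = k s := fun s hs => (hK.1.coe_toReal hs).symm
  have mono : ∀ s t, 0 < s → s ≤ t → k s ≤ k t := fun s t hs hst => by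
    have := hK.2.2 hs (hs.trans_le hst) hst
    rw [hKk s hs.ne', hKk t (hs.trans_le hst).ne'] at this
    exact_mod_cast this
  have anti : ∀ s t, t < 0 → s ≤ t → k t ≤ k s := fun s t ht hst => by
    have := hK.2.1 (hst.trans_lt ht) ht hst
    rw [hKk t ht.ne, hKk s (hst.trans_lt ht).ne] at this
    exact_mod_cast this
  refine ⟨k (1 + (δ + a)) - k 1 + |k δ| + |k (-δ)| + |k 1|, fun t ht x y hx hxy => ?_⟩
  have hD : k (t + (δ + a)) + k 1 ≤ k (1 + (δ + a)) + k t :=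
    hK.1.2.2.1.add_le_add_of_pos one_pos (by linarith) (by linarith)
  have hD0 : k 1 ≤ k (1 + (δ + a)) := mono _ _ one_pos (by linarith)
  have hx' := abs_le.mp hx
  have b1 := neg_abs_le (k δ)
  have b2 := neg_abs_le (k (-δ))
  have b3 := neg_abs_le (k 1)
  have b1' := le_abs_self (k δ)
  have b4 := abs_nonneg (k (-δ))
  have b5 := abs_nonneg (k δ)
  have b6 := abs_nonneg (k 1)
  have hkt : k 1 ≤ k t := mono _ _ one_pos (by linarith)
  change K (t - y) ≤ ((k (x - y) + k t + _ : ℝ) : EReal)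
  rcases le_total y x with hyx | hyx
  · rw [abs_of_nonneg (sub_nonneg.mpr hyx)] at hxy
    have h1 := hK.1.2.2.1.add_le_add_of_pos hδ hxy (h := t - x) (by linarith)
    change k (x - y + (t - x)) + k δ ≤ k (δ + (t - x)) + k (x - y) at h1
    have h2 : k (δ + (t - x)) ≤ k (t + (δ + a)) := mono _ _ (by linarith) (by linarith)
    have e : x - y + (t - x) = t - y := by ring
    rw [e] at h1
    rw [hKk (t - y) (by linarith), EReal.coe_le_coe_iff]
    linarith
  · rw [abs_of_nonpos (sub_nonpos.mpr hyx)] at hxy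
    have h1 : k (-δ) ≤ k (x - y) := anti _ _ (by linarith) (by linarith)
    rcases lt_trichotomy (t - y) 0 with h | h | h
    · rw [hKk (t - y) h.ne, EReal.coe_le_coe_iff]
      have := anti (x - y) (t - y) h (by linarith)
      linarith
    · rw [h]
      refine (hK.apply_zero_le (x - y)).trans ?_
      rw [hKk (x - y) (by linarith), EReal.coe_le_coe_iff]
      linarith
    · rw [hKk (t - y) h.ne', EReal.coe_le_coe_iff]
      have := mono (t - y) (t + (δ + a)) h (by linarith)
      linarith

lemma MonotoneKernel.exists_tail_bound {K : ℝ → EReal} (hK : MonotoneKernel K) {a δ : ℝ}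
    (ha : 0 < a) (hδ : 0 < δ) :
    ∃ C : ℝ, ∀ t, a + 1 ≤ |t| → ∀ x y : ℝ, |x| ≤ a → δ ≤ |x - y| →
      K (t - y) ≤ (((K (x - y)).toReal + (K t).toReal + C : ℝ) : EReal) := by
  obtain ⟨C, hC⟩ := hK.exists_tail_bound_right ha hδ
  obtain ⟨C', hC'⟩ := hK.comp_neg.exists_tail_bound_right ha hδ
  refine ⟨max C C', fun t ht x y hx hxy => ?_⟩
  rcases le_abs.mp ht with h | h
  · refine (hC t h x y hx hxy).trans (EReal.coe_le_coe_iff.mpr ?_)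
    have := le_max_left C C'
    linarith
  · have := hC' (-t) h (-x) (-y) (by rwa [abs_neg]) (by
      rw [show -x - -y = -(x - y) by ring, abs_neg]; exact hxy)
    rw [show -(-t - -y) = t - y by ring, show -(-x - -y) = x - y by ring, neg_neg] at this
    refine this.trans (EReal.coe_le_coe_iff.mpr ?_)
    have := le_max_right C C'
    linarith

lemma Finset.exists_separation {n : ℕ} (S : Finset ℝ) (hS : n < S.card) :
    ∃ δ > 0, ∀ y : Fin n → ℝ, ∃ x ∈ S, ∀ j, δ ≤ |x - y j| := by
  obtain ⟨d, hd, hsep⟩ : ∃ d > 0, ∀ x ∈ S, ∀ z ∈ S, x ≠ z → d ≤ dist x z := by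
    rcases (S : Set ℝ).subsingleton_or_nontrivial with h | h
    · exact ⟨1, one_pos, fun x hx z hz hne => (hne (h hx hz)).elim⟩
    · exact ⟨_, S.finite_toSet.infsep_pos_iff_nontrivial.mpr h,
        fun x hx z hz hne => infsep_le_dist_of_mem hx hz hne⟩
  refine ⟨d / 2, by positivity, fun y => ?_⟩
  by_contra! hcon
  choose f hf using fun x : S => hcon x x.2
  obtain ⟨x, z, hne, heq⟩ := Fintype.exists_ne_map_eq_of_card_lt f (by simpa using hS)
  have h1 := hf x
  have h2 := hf z
  rw [← heq] at h2
  have h3 := hsep x x.2 z z.2 fun h => hne (Subtype.ext h)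
  rw [Real.dist_eq] at h3
  have h4 := abs_sub_le (x : ℝ) (y (f x)) z
  rw [abs_sub_comm (y (f x)) z] at h4
  linarith

lemma IsKernel.sum_eq_coe {K : ℝ → EReal} (hK : IsKernel K) {n : ℕ} (r y : Fin n → ℝ) {t : ℝ}
    (ht : ∀ j, t - y j ≠ 0) :
    ∑ j, (r j : EReal) * K (t - y j) = ((∑ j, r j * (K (t - y j)).toReal : ℝ) : EReal) := by
  rw [EReal.coe_finset_sum]
  refine Finset.sum_congr rfl fun j _ => ?_
  rw [EReal.coe_mul, hK.coe_toReal (ht j)]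

/-- Outside a large interval the sum of translates stays below its value at some point of the
interval, uniformly in the nodes. -/
theorem MonotoneKernel.exists_radius {K J : ℝ → EReal} (hK : MonotoneKernel K) {n : ℕ}
    {r : Fin n → ℝ} (hr : ∀ j, 0 < r j) (hJ : IsFieldFn n J) (hadm : IsAdmissible K J (∑ j, r j)) :
    ∃ q > 0, ∀ y : Fin n → ℝ, ∃ x, |x| < q ∧ ∃ c : ℝ, (c : EReal) < SumTrans K J r y x ∧
      ∀ t, q ≤ |t| → SumTrans K J r y t ≤ c := by
  obtain ⟨⟨b, hb⟩, S, hS, hSJ⟩ := hJ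
  have hJtop : ∀ t, J t ≠ ⊤ := fun t => ((hb t).trans_lt (EReal.coe_lt_top b)).ne
  obtain ⟨δ, hδ, hsep⟩ := S.exists_separation hS
  obtain ⟨m, hm⟩ := (S.finite_toSet.image (fun x => (J x).toReal)).bddBelow
  obtain ⟨a, ha⟩ := (S.finite_toSet.image (fun x => |x|)).bddAbove
  have ha1 : 0 < max a 1 := lt_max_of_lt_right one_pos
  have hSa : ∀ x ∈ S, |x| ≤ max a 1 := fun x hx =>
    (ha (mem_image_of_mem _ hx)).trans (le_max_left _ _)
  obtain ⟨C, hC⟩ := hK.exists_tail_bound ha1 hδ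
  have hev := hadm.eventually_lt_const (EReal.bot_lt_coe (m - 1 - (∑ j, r j) * C))
  obtain ⟨T, hT⟩ : ∃ T : ℝ, ∀ t : ℝ, T ≤ |t| →
      J t + ((∑ j, r j : ℝ) : EReal) * K t < ((m - 1 - (∑ j, r j) * C : ℝ) : EReal) := by
    obtain ⟨u, hu, hsub⟩ := mem_cocompact.mp hev
    obtain ⟨T, hT⟩ := hu.isBounded.exists_norm_le
    refine ⟨T + 1, fun t ht => hsub fun htu => ?_⟩
    have := hT t htu
    rw [Real.norm_eq_abs] at this
    linarith
  refine ⟨max T (max a 1 + 1), lt_max_of_lt_right (by linarith), fun y => ?_⟩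
  obtain ⟨x, hxS, hx⟩ := hsep y
  have hxy : ∀ j, x - y j ≠ 0 := fun j => abs_pos.mp (hδ.trans_le (hx j))
  refine ⟨x, lt_max_of_lt_right ((hSa x hxS).trans_lt (lt_add_one _)),
    m - 1 + ∑ j, r j * (K (x - y j)).toReal, ?_, fun t ht => ?_⟩
  · have h1 : m ≤ (J x).toReal := hm (mem_image_of_mem _ hxS)
    unfold SumTrans
    rw [hK.1.sum_eq_coe r y hxy, ← EReal.coe_toReal (hJtop x) (hSJ x hxS), ← EReal.coe_add,
      EReal.coe_lt_coe_iff]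
    linarith
  · have ht1 := (le_max_right _ _).trans ht
    have ht0 : t ≠ 0 := abs_pos.mp (by linarith)
    have h1 := hT t ((le_max_left _ _).trans ht)
    have h2 : ∑ j, (r j : EReal) * K (t - y j) ≤
        ((∑ j, r j * ((K (x - y j)).toReal + (K t).toReal + C) : ℝ) : EReal) := by
      rw [EReal.coe_finset_sum]
      refine Finset.sum_le_sum fun j _ => ?_
      rw [EReal.coe_mul]
      exact mul_le_mul_of_nonneg_left (hC t ht1 x (y j) (hSa x hxS) (hx j))
        (by exact_mod_cast (hr j).le)
    unfold SumTrans
    refine (add_le_add_right h2 (J t)).trans ?_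
    by_cases hbot : J t = ⊥
    · rw [hbot, EReal.bot_add]; exact bot_le
    rw [← EReal.coe_toReal (hJtop t) hbot, ← EReal.coe_add, EReal.coe_le_coe_iff]
    rw [← EReal.coe_toReal (hJtop t) hbot, ← hK.1.coe_toReal ht0, ← EReal.coe_mul,
      ← EReal.coe_add, EReal.coe_lt_coe_iff] at h1
    have h3 : ∑ j, r j * ((K (x - y j)).toReal + (K t).toReal + C) =
        ∑ j, r j * (K (x - y j)).toReal + (∑ j, r j) * (K t).toReal + (∑ j, r j) * C := by
      rw [Finset.sum_mul, Finset.sum_mul, ← Finset.sum_add_distrib, ← Finset.sum_add_distrib]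
      exact Finset.sum_congr rfl fun j _ => by ring
    rw [h3]
    linarith

lemma continuous_ereal_sum {X ι : Type*} [TopologicalSpace X] (s : Finset ι) {f : ι → X → EReal}
    (hc : ∀ i, Continuous (f i)) (ht : ∀ i x, f i x ≠ ⊤) :
    Continuous (fun x => ∑ i ∈ s, f i x) ∧ ∀ x, ∑ i ∈ s, f i x ≠ ⊤ := by
  classical
  induction s using Finset.induction_on with
  | empty => simp [continuous_const]
  | insert a s ha ih =>
    simp only [Finset.sum_insert ha]
    refine ⟨continuous_iff_continuousAt.mpr fun x => ?_,
      fun x => EReal.add_ne_top (ht a x) (ih.2 x)⟩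
    exact ContinuousAt.comp (g := fun p : EReal × EReal => p.1 + p.2)
      (f := fun x => (f a x, ∑ i ∈ s, f i x))
      (EReal.continuousAt_add (Or.inl (ht a x)) (Or.inr (ih.2 x)))
      ((hc a).continuousAt.prodMk ih.1.continuousAt)

lemma EReal.continuous_coe_mul_of_pos {c : ℝ} (hc : 0 < c) :
    Continuous fun x : EReal => (c : EReal) * x := by
  refine continuous_iff_continuousAt.mpr fun x => ?_
  have hc' : (c : EReal) ≠ 0 := by exact_mod_cast hc.ne'
  exact ContinuousAt.comp (g := fun p : EReal × EReal => p.1 * p.2) (f := fun x => ((c : EReal), x))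
    (EReal.continuousAt_mul (Or.inl hc') (Or.inl hc') (Or.inl (EReal.coe_ne_bot c))
      (Or.inl (EReal.coe_ne_top c)))
    (continuousAt_const.prodMk continuousAt_id)

lemma EReal.coe_mul_ne_top {c : ℝ} (hc : 0 < c) {x : EReal} (hx : x ≠ ⊤) : (c : EReal) * x ≠ ⊤ := by
  induction x with
  | bot => rw [EReal.coe_mul_bot_of_pos hc]; exact bot_ne_top
  | coe x => rw [← EReal.coe_mul]; exact EReal.coe_ne_top _
  | top => exact absurd rfl hx

lemma IsKernel.continuous_sum_translates {K : ℝ → EReal} (hK : IsKernel K) {n : ℕ}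
    {r : Fin n → ℝ} (hr : ∀ j, 0 < r j) :
    Continuous (fun p : (Fin n → ℝ) × ℝ => ∑ j, (r j : EReal) * K (p.2 - p.1 j)) ∧
      ∀ p : (Fin n → ℝ) × ℝ, ∑ j, (r j : EReal) * K (p.2 - p.1 j) ≠ ⊤ :=
  continuous_ereal_sum _
    (fun j => (EReal.continuous_coe_mul_of_pos (hr j)).comp (hK.continuous.comp (by fun_prop)))
    (fun j _ => EReal.coe_mul_ne_top (hr j) (hK.ne_top _))

lemma sum_translates_eq_bot {K : ℝ → EReal} (hK0 : K 0 = ⊥) {n : ℕ}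
    {r : Fin n → ℝ} (hr : ∀ j, 0 < r j) {y : Fin n → ℝ} {t : ℝ} {i : Fin n} (h : t = y i) :
    ∑ j, (r j : EReal) * K (t - y j) = ⊥ := by
  rw [← Finset.add_sum_erase _ _ (Finset.mem_univ i), h, sub_self, hK0,
    EReal.coe_mul_bot_of_pos (hr i), EReal.bot_add]

lemma exists_mem_cell {n : ℕ} {y : Fin n → ℝ} (hy : Monotone y) (t : ℝ) : ∃ j, t ∈ cell y j := by
  by_cases h : {i | t < y i}.Nonempty
  · obtain ⟨i, hi, hmin⟩ := wellFounded_lt.has_min _ h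
    refine ⟨i.castSucc, fun i' h' => ?_, fun i' h' => ?_⟩
    · by_contra hcon
      exact hmin i' (not_le.mp hcon) (by simpa using h')
    · exact (le_of_lt hi).trans (hy (by simpa using h'))
  · refine ⟨Fin.last n, fun i _ => ?_,
      fun i hi => absurd i.isLt (not_lt.mpr (by simpa only [Fin.val_last] using hi))⟩
    by_contra hcon
    exact h ⟨i, not_le.mp hcon⟩

lemma le_mloc {K J : ℝ → EReal} {n : ℕ} {r y : Fin n → ℝ} {j : Fin (n + 1)} {t : ℝ}
    (ht : t ∈ cell y j) : SumTrans K J r y t ≤ mloc K J r y j :=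
  le_sSup (mem_image_of_mem _ ht)

lemma le_mloc_of_forall_mloc_le {K J : ℝ → EReal} {n : ℕ} {r y : Fin n → ℝ} (hy : Monotone y)
    {j : Fin (n + 1)} (hj : ∀ i, mloc K J r y i ≤ mloc K J r y j) (t : ℝ) :
    SumTrans K J r y t ≤ mloc K J r y j := by
  obtain ⟨i, hi⟩ := exists_mem_cell hy t
  exact (le_mloc hi).trans (hj i)

lemma mem_cell_of_tendsto {n : ℕ} {u : ℕ → Fin n → ℝ} {s : ℕ → ℝ} {y : Fin n → ℝ} {t : ℝ}
    {j : Fin (n + 1)} (hu : Tendsto u atTop (𝓝 y)) (hs : Tendsto s atTop (𝓝 t))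
    (h : ∀ k, s k ∈ cell (u k) j) : t ∈ cell y j :=
  ⟨fun i hi => le_of_tendsto_of_tendsto' (tendsto_pi_nhds.mp hu i) hs fun k => (h k).1 i hi,
    fun i hi => le_of_tendsto_of_tendsto' hs (tendsto_pi_nhds.mp hu i) fun k => (h k).2 i hi⟩

/-- Upper semicontinuity of the local maxima, in sequential form. -/
lemma le_mloc_of_tendsto {K J : ℝ → EReal} (hK : IsKernel K) {n : ℕ} {r : Fin n → ℝ}
    (hr : ∀ j, 0 < r j) {b : ℝ} (hb : ∀ t, J t ≤ (b : EReal))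
    (hextra : UpperSemicontinuous J ∨ K 0 = ⊥)
    {u : ℕ → Fin n → ℝ} {s : ℕ → ℝ} {y : Fin n → ℝ} {t : ℝ} {j : Fin (n + 1)} {c : ℝ}
    (hu : Tendsto u atTop (𝓝 y)) (hs : Tendsto s atTop (𝓝 t)) (hmem : ∀ k, s k ∈ cell (u k) j)
    (hc : ∀ k, (c : EReal) < SumTrans K J r (u k) (s k)) : (c : EReal) ≤ mloc K J r y j := by
  have hJtop : ∀ t, J t ≠ ⊤ := fun t => ((hb t).trans_lt (EReal.coe_lt_top b)).ne
  obtain ⟨hScont, hStop⟩ := hK.continuous_sum_translates hr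
  have htc : t ∈ cell y j := mem_cell_of_tendsto hu hs hmem
  have hlim : Tendsto (fun k => (u k, s k)) atTop (𝓝 (y, t)) := hu.prodMk_nhds hs
  have hSlim := (hScont.tendsto (y, t)).comp hlim
  by_contra! hlt
  rcases hextra with husc | hK0
  · have h1 : UpperSemicontinuousAt (fun p : (Fin n → ℝ) × ℝ => SumTrans K J r p.1 p.2) (y, t) :=
      UpperSemicontinuousAt.add' (f := fun p : (Fin n → ℝ) × ℝ => J p.2)
        (UpperSemicontinuousAt.comp (g := Prod.snd) (c := (y, t)) (husc t) continuousAt_snd)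
        hScont.continuousAt.upperSemicontinuousAt
        (EReal.continuousAt_add (Or.inl (hJtop t)) (Or.inr (hStop (y, t))))
    have h2 := hlim.eventually (h1 c ((le_mloc htc).trans_lt hlt))
    obtain ⟨k, hk⟩ := h2.exists
    exact lt_asymm hk (hc k)
  · by_cases hnode : ∃ i, t = y i
    · obtain ⟨i, hi⟩ := hnode
      have h1 : ∑ j, (r j : EReal) * K (t - y j) < ((c - b : ℝ) : EReal) := by
        rw [sum_translates_eq_bot hK0 hr hi]; exact EReal.bot_lt_coe _
      obtain ⟨k, hk⟩ := (hSlim.eventually_lt_const h1).exists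
      have h2 := EReal.add_lt_add_left_coe hk b
      rw [← EReal.coe_add, add_sub_cancel] at h2
      exact lt_irrefl _ ((hc k).trans ((add_le_add_left (hb (s k)) _).trans_lt h2))
    · push Not at hnode
      obtain ⟨c', hc'1, hc'2⟩ := EReal.lt_iff_exists_real_btwn.mp hlt
      have hcc : c' < c := by exact_mod_cast hc'2
      have hev : ∀ᶠ k in atTop, s k ∈ cell y j := by
        have h1 : ∀ᶠ k in atTop, ∀ i : Fin n, (i : ℕ) < j → y i ≤ s k := by
          refine eventually_all.mpr fun i => ?_
          by_cases hi : (i : ℕ) < j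
          · filter_upwards [hs.eventually_const_lt ((htc.1 i hi).lt_of_ne (hnode i).symm)] with k hk
            exact fun _ => hk.le
          · exact Eventually.of_forall fun k h => absurd h hi
        have h2 : ∀ᶠ k in atTop, ∀ i : Fin n, (j : ℕ) ≤ i → s k ≤ y i := by
          refine eventually_all.mpr fun i => ?_
          by_cases hi : (j : ℕ) ≤ i
          · filter_upwards [hs.eventually_lt_const ((htc.2 i hi).lt_of_ne (hnode i))] with k hk
            exact fun _ => hk.le
          · exact Eventually.of_forall fun k h => absurd h hi
        filter_upwards [h1, h2] with k hk1 hk2 using ⟨hk1, hk2⟩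
      have hσ := hK.sum_eq_coe r y (t := t) fun i => sub_ne_zero.mpr (hnode i)
      generalize (∑ j, r j * (K (t - y j)).toReal) = σ at hσ
      have hSlim' := (hScont.tendsto (y, t)).comp ((tendsto_const_nhds (x := y)).prodMk_nhds hs)
      simp only [hσ] at hSlim hSlim'
      have e1 := hSlim.eventually_lt_const
        (EReal.coe_lt_coe_iff.mpr (show σ < σ + (c - c') / 2 by linarith))
      have e2 := hSlim'.eventually_const_lt
        (EReal.coe_lt_coe_iff.mpr (show σ - (c - c') / 2 < σ by linarith))
      obtain ⟨k, hk, hk1, hk2⟩ := (hev.and (e1.and e2)).exists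
      have f1 := (hc k).trans_le (add_le_add_right hk1.le (J (s k)))
      have f2 := ((add_le_add_right hk2.le (J (s k))).trans (le_mloc hk)).trans_lt hc'1
      by_cases hbot : J (s k) = ⊥
      · rw [hbot, EReal.bot_add] at f1
        exact not_lt_bot f1
      · rw [← EReal.coe_toReal (hJtop _) hbot, ← EReal.coe_add, EReal.coe_lt_coe_iff] at f1 f2
        linarith

/-- Passing to the limit in the property that the `j`-th local maximum is the global one. -/
lemma sumTrans_le_mloc_of_tendsto {K J : ℝ → EReal} (hK : IsKernel K) {n : ℕ} {r : Fin n → ℝ}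
    (hr : ∀ j, 0 < r j) {b : ℝ} (hb : ∀ t, J t ≤ (b : EReal))
    (hextra : UpperSemicontinuous J ∨ K 0 = ⊥) {q : ℝ}
    (hq : ∀ y : Fin n → ℝ, ∃ x, |x| < q ∧ ∃ c : ℝ, (c : EReal) < SumTrans K J r y x ∧
      ∀ t, q ≤ |t| → SumTrans K J r y t ≤ c)
    {u : ℕ → Fin n → ℝ} {y : Fin n → ℝ} {j : Fin (n + 1)}
    (hu : Tendsto u atTop (𝓝 y)) (hmono : ∀ k, Monotone (u k))
    (hj : ∀ k i, mloc K J r (u k) i ≤ mloc K J r (u k) j) (t : ℝ) :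
    SumTrans K J r y t ≤ mloc K J r y j := by
  have hJtop : J t ≠ ⊤ := ((hb t).trans_lt (EReal.coe_lt_top b)).ne
  obtain ⟨hScont, hStop⟩ := hK.continuous_sum_translates hr
  refine EReal.ge_of_forall_gt_iff_ge.mp fun c hct => ?_
  have hlim : Tendsto (fun k => SumTrans K J r (u k) t) atTop (𝓝 (SumTrans K J r y t)) :=
    ((EReal.continuousAt_add (p := (J t, ∑ j, (r j : EReal) * K (t - y j))) (Or.inl hJtop)
      (Or.inr (hStop (y, t)))).tendsto).comp
      (tendsto_const_nhds.prodMk_nhds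
        ((hScont.tendsto (y, t)).comp (hu.prodMk_nhds (tendsto_const_nhds (x := t)))))
  obtain ⟨N, hN⟩ := eventually_atTop.mp (hlim.eventually_const_lt hct)
  have hex : ∀ k, ∃ s ∈ Icc (-q) q, s ∈ cell (u (k + N)) j ∧
      (c : EReal) < SumTrans K J r (u (k + N)) s := by
    intro k
    obtain ⟨x, -, d, hdx, hd⟩ := hq (u (k + N))
    have hmax := le_mloc_of_forall_mloc_le (hmono (k + N)) (hj (k + N))
    have hlt : max (c : EReal) d < mloc K J r (u (k + N)) j :=
      max_lt ((hN _ (Nat.le_add_left N k)).trans_le (hmax t)) (hdx.trans_le (hmax x))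
    obtain ⟨_, ⟨s, hs, rfl⟩, hlt⟩ := lt_sSup_iff.mp hlt
    refine ⟨s, abs_le.mp (le_of_not_gt fun hqs => ?_), hs, (le_max_left _ _).trans_lt hlt⟩
    exact lt_irrefl _ (((le_max_right _ _).trans_lt hlt).trans_le (hd s hqs.le))
  choose s hsq hsc hs using hex
  obtain ⟨τ, -, φ, hφ, hτ⟩ := isCompact_Icc.tendsto_subseq hsq
  exact le_mloc_of_tendsto hK hr hb hextra
    (((tendsto_add_atTop_iff_nat N).mpr hu).comp hφ.tendsto_atTop) hτ
    (fun k => hsc (φ k)) (fun k => hs (φ k))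

lemma not_forall_mloc_le_of_cell_subset {K J : ℝ → EReal} {n : ℕ} {r y : Fin n → ℝ} {q : ℝ}
    (hy : Monotone y)
    (hq : ∃ x, |x| < q ∧ ∃ c : ℝ, (c : EReal) < SumTrans K J r y x ∧
      ∀ t, q ≤ |t| → SumTrans K J r y t ≤ c) {j : Fin (n + 1)}
    (hcell : ∀ t ∈ cell y j, q ≤ |t|) : ¬ ∀ i, mloc K J r y i ≤ mloc K J r y j := by
  intro hj
  obtain ⟨x, -, c, hcx, hc⟩ := hq
  have h1 : mloc K J r y j ≤ c := sSup_le (by rintro _ ⟨t, ht, rfl⟩; exact hc t (hcell t ht))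
  exact lt_irrefl _ ((hcx.trans_le (le_mloc_of_forall_mloc_le hy hj x)).trans_le h1)

/-- A continuous parametrization of the ordered node systems in `[-q, q]` by the unit cube. -/
def cubeNodes (q : ℝ) {n : ℕ} (x : Fin n → ℝ) (k : Fin n) : ℝ :=
  (Finset.Iic k).sup' Finset.nonempty_Iic fun i => q - 2 * q * x i

lemma monotone_cubeNodes (q : ℝ) {n : ℕ} (x : Fin n → ℝ) : Monotone (cubeNodes q x) :=
  fun _ _ h => Finset.sup'_mono _ (Finset.Iic_subset_Iic.mpr h) _

lemma continuous_cubeNodes (q : ℝ) {n : ℕ} :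
    Continuous (cubeNodes q : (Fin n → ℝ) → Fin n → ℝ) :=
  continuous_pi fun _ => Continuous.finset_sup'_apply _ fun _ _ => by fun_prop

lemma le_cubeNodes (q : ℝ) {n : ℕ} (x : Fin n → ℝ) {i k : Fin n} (h : i ≤ k) :
    q - 2 * q * x i ≤ cubeNodes q x k :=
  Finset.le_sup' (fun i => q - 2 * q * x i) (Finset.mem_Iic.mpr h)

lemma neg_le_cubeNodes {q : ℝ} (hq : 0 < q) {n : ℕ} {x : Fin n → ℝ} (hx : x ≤ 1) (k : Fin n) :
    -q ≤ cubeNodes q x k := by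
  refine le_trans ?_ (le_cubeNodes q x le_rfl)
  have := mul_le_mul_of_nonneg_left (hx k) hq.le
  simp only [Pi.one_apply] at this
  linarith

/-- The least index of a maximal local maximum. -/
def argmaxLabel (K J : ℝ → EReal) {n : ℕ} (r y : Fin n → ℝ) : ℕ :=
  sInf {j : ℕ | ∃ h : j < n + 1, ∀ i, mloc K J r y i ≤ mloc K J r y ⟨j, h⟩}

lemma argmaxLabel_spec (K J : ℝ → EReal) {n : ℕ} (r y : Fin n → ℝ) :
    ∃ h : argmaxLabel K J r y < n + 1,
      ∀ i, mloc K J r y i ≤ mloc K J r y ⟨argmaxLabel K J r y, h⟩ := by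
  refine Nat.sInf_mem (s := {j : ℕ | ∃ h : j < n + 1, ∀ i, mloc K J r y i ≤ mloc K J r y ⟨j, h⟩}) ?_
  obtain ⟨j, hj⟩ := Finite.exists_max (mloc K J r y)
  exact ⟨j, j.isLt, hj⟩

lemma argmaxLabel_le {K J : ℝ → EReal} {n : ℕ} {r y : Fin n → ℝ} {j : Fin (n + 1)}
    (hj : ∀ i, mloc K J r y i ≤ mloc K J r y j) : argmaxLabel K J r y ≤ j :=
  Nat.sInf_le ⟨j.isLt, hj⟩

/-- if moreover `J` is upper semicontinuous or `K` is singular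
(`K(0) = -∞`), then there exists an equioscillation point on `ℝ`. -/
theorem equioscillation_exists (K J : ℝ → EReal) (hK : MonotoneKernel K)
    (n : ℕ) (hn : 0 < n) (r : Fin n → ℝ) (hr : ∀ j, 0 < r j)
    (hJ : IsFieldFn n J) (hadm : IsAdmissible K J (∑ j, r j))
    (hextra : UpperSemicontinuous J ∨ K 0 = ⊥) :
    ∃ e : Fin n → ℝ, Monotone e ∧
      ∀ j j' : Fin (n + 1), mloc K J r e j = mloc K J r e j' := by
  obtain ⟨b, hb⟩ := hJ.1
  obtain ⟨q, hq0, hq⟩ := hK.exists_radius hr hJ hadm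
  have hlabel_le : ∀ x ∈ Icc (0 : Fin n → ℝ) 1, argmaxLabel K J r (cubeNodes q x) ≤ n := by
    intro x _
    exact Nat.lt_succ_iff.mp (argmaxLabel_spec K J r (cubeNodes q x)).1
  have hlabel_one : ∀ x ∈ Icc (0 : Fin n → ℝ) 1, ∀ i, x i = 1 →
      argmaxLabel K J r (cubeNodes q x) ≠ i := by
    intro x hx i hxi heq
    obtain ⟨h, hspec⟩ := argmaxLabel_spec K J r (cubeNodes q x)
    have hmono := monotone_cubeNodes q x
    have hi : (⟨_, h⟩ : Fin (n + 1)) = i.castSucc := Fin.ext heq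
    rw [hi] at hspec
    rcases Nat.eq_zero_or_pos (i : ℕ) with h0 | h0
    · refine not_forall_mloc_le_of_cell_subset hmono (hq _) (fun t ht => ?_) hspec
      have h1 : t ≤ cubeNodes q x i := ht.2 i (by simp)
      have h2 : cubeNodes q x i ≤ -q := by
        refine Finset.sup'_le _ _ fun k hk => ?_
        have : k = i := le_antisymm (Finset.mem_Iic.mp hk)
          (by rw [Fin.le_def, h0]; exact Nat.zero_le _)
        rw [this, hxi]; linarith
      exact le_abs.mpr (Or.inr (by linarith))
    · obtain ⟨m, hm⟩ := Nat.exists_eq_add_of_le' h0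
      have hmn : m < n := by have := i.isLt; omega
      have hnode : cubeNodes q x i ≤ cubeNodes q x ⟨m, hmn⟩ := by
        refine Finset.sup'_le _ _ fun k hk => ?_
        rcases (Finset.mem_Iic.mp hk).eq_or_lt with rfl | hlt
        · refine le_trans ?_ (neg_le_cubeNodes hq0 hx.2 _)
          rw [hxi]; linarith
        · refine le_cubeNodes q x (Fin.le_def.mpr ?_)
          have := Fin.lt_def.mp hlt
          simp only; omega
      have hsub : cell (cubeNodes q x) i.castSucc ⊆
          cell (cubeNodes q x) (⟨m, hmn⟩ : Fin n).castSucc := by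
        refine fun t ht => ⟨fun k hk => ht.1 k ?_, fun k hk => ?_⟩
        · simp only [Fin.val_castSucc] at hk ⊢; omega
        · exact (ht.2 i (by simp)).trans (hnode.trans (hmono (Fin.le_def.mpr (by simpa using hk))))
      have hcell : mloc K J r (cubeNodes q x) i.castSucc ≤
          mloc K J r (cubeNodes q x) (⟨m, hmn⟩ : Fin n).castSucc := sSup_le_sSup (image_mono hsub)
      have := argmaxLabel_le fun k => (hspec k).trans hcell
      simp only [Fin.val_castSucc] at this
      omega
  have hlabel_zero : ∀ x ∈ Icc (0 : Fin n → ℝ) 1, ∀ i, x i = 0 →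
      argmaxLabel K J r (cubeNodes q x) ≤ i := by
    intro x hx i hxi
    by_contra! hlt
    obtain ⟨h, hspec⟩ := argmaxLabel_spec K J r (cubeNodes q x)
    refine not_forall_mloc_le_of_cell_subset (monotone_cubeNodes q x) (hq _) (fun t ht => ?_) hspec
    have h1 := le_cubeNodes q x (le_refl i)
    rw [hxi, mul_zero, sub_zero] at h1
    exact le_abs.mpr (Or.inl (h1.trans (ht.1 i hlt)))
  obtain ⟨a, -, ha⟩ := exists_mem_closure_of_cube_labelling
    (fun x : Fin n → ℝ => argmaxLabel K J r (cubeNodes q x)) hlabel_le hlabel_one hlabel_zero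
  have hmax : ∀ (j : Fin (n + 1)) t,
      SumTrans K J r (cubeNodes q a) t ≤ mloc K J r (cubeNodes q a) j := by
    intro j t
    obtain ⟨z, hz, hza⟩ := mem_closure_iff_seq_limit.mp (ha j (Nat.lt_succ_iff.mp j.isLt))
    refine sumTrans_le_mloc_of_tendsto hK.1 hr hb hextra hq
      (((continuous_cubeNodes q).tendsto a).comp hza) (fun k => monotone_cubeNodes q (z k))
      (fun k => ?_) t
    obtain ⟨h, hspec⟩ := argmaxLabel_spec K J r (cubeNodes q (z k))
    have : (⟨_, h⟩ : Fin (n + 1)) = j := Fin.ext (hz k).2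
    rwa [this] at hspec
  have hle : ∀ j j', mloc K J r (cubeNodes q a) j ≤ mloc K J r (cubeNodes q a) j' := by
    intro j j'
    refine sSup_le ?_
    rintro _ ⟨t, -, rfl⟩
    exact hmax j' t
  exact ⟨cubeNodes q a, monotone_cubeNodes q a, fun j j' => le_antisymm (hle j j') (hle j' j)⟩
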